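/- If x is a standard p-dimensional Gaussian vector and A is any p×p real matrix, then E[(x'Ax − tr(A))⁴] = 3·tr((A + Aᵀ)⁴) + (3/4)·(tr((A + Aᵀ)²))². -/

import Mathlib

open MeasureTheory ProbabilityTheory Matrix

noncomputable def stdGaussian (p : ℕ) : Measure (Fin p → ℝ) :=
  Measure.pi fun _ => gaussianReal 0 1

lemma iteratedDeriv_mgf_gaussianReal_add_two (n : ℕ) :
    iteratedDeriv (n + 2) (mgf id (gaussianReal 0 1)) = fun t ↦
      t * iteratedDeriv (n + 1) (mgf id (gaussianReal 0 1)) t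
        + (n + 1) * iteratedDeriv n (mgf id (gaussianReal 0 1)) t := by
  have hM : mgf id (gaussianReal 0 1) = fun t ↦ Real.exp (t ^ 2 / 2) := by
    simp [mgf_id_gaussianReal]
  have hdiff : ∀ k, Differentiable ℝ (iteratedDeriv k (mgf id (gaussianReal 0 1))) := by
    intro k
    have hc : ContDiff ℝ (k + 1 : ℕ) (mgf id (gaussianReal 0 1)) := by
      rw [hM]; fun_prop
    exact hc.differentiable_iteratedDeriv k (by exact_mod_cast Nat.lt_succ_self k)
  induction n with
  | zero =>
    have h1 : iteratedDeriv 1 (mgf id (gaussianReal 0 1)) =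
        fun t ↦ t * mgf id (gaussianReal 0 1) t := by
      ext t
      rw [iteratedDeriv_one, hM, _root_.deriv_exp (by fun_prop)]
      simp
      ring
    rw [iteratedDeriv_succ]
    ext t
    have h0 := hdiff 0
    rw [iteratedDeriv_zero] at h0
    conv_lhs => rw [h1]
    rw [deriv_fun_mul (by fun_prop) (h0 t), ← iteratedDeriv_one]
    simp
    ring
  | succ n ih =>
    conv_lhs => rw [iteratedDeriv_succ, ih]
    ext t
    rw [deriv_fun_add (differentiableAt_fun_id.fun_mul (hdiff _ t)) ((hdiff _ t).const_mul _),
      deriv_fun_mul (by fun_prop) (hdiff _ t), deriv_const_mul _ (hdiff _ t),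
      ← iteratedDeriv_succ, ← iteratedDeriv_succ]
    simp
    ring

lemma integral_pow_add_two_gaussianReal (n : ℕ) :
    ∫ x, x ^ (n + 2) ∂gaussianReal 0 1 = (n + 1) * ∫ x, x ^ n ∂gaussianReal 0 1 := by
  have h := congrFun (iteratedDeriv_mgf_gaussianReal_add_two n) 0
  simp only [zero_mul, zero_add] at h
  rw [iteratedDeriv_mgf_zero (by simp), iteratedDeriv_mgf_zero (by simp)] at h
  simpa using h

lemma MeasureTheory.MemLp.integrable_pow {Ω : Type*} {mΩ : MeasurableSpace Ω} {μ : Measure Ω}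
    [IsFiniteMeasure μ] {X : Ω → ℝ} {n : ℕ} (hX : MemLp X n μ) :
    Integrable (fun ω ↦ X ω ^ n) μ :=
  (integrable_norm_iff (hX.aestronglyMeasurable.pow n)).1 (by simpa using hX.integrable_norm_pow')

lemma integrable_pow_gaussianReal (n : ℕ) : Integrable (fun x ↦ x ^ n) (gaussianReal 0 1) :=
  MemLp.integrable_pow (memLp_id_gaussianReal' n (by simp))

lemma memLp_sq_sub_one_gaussianReal : MemLp (fun x ↦ x ^ 2 - 1) 4 (gaussianReal 0 1) := by
  have h : Integrable (fun x : ℝ ↦ ‖x ^ 2 - 1‖ ^ 4) (gaussianReal 0 1) := by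
    have : (fun x : ℝ ↦ ‖x ^ 2 - 1‖ ^ 4) =
        fun x ↦ x ^ 8 - 4 * x ^ 6 + 6 * x ^ 4 - 4 * x ^ 2 + 1 := by
      ext x
      rw [Real.norm_eq_abs, Even.pow_abs (by decide)]
      ring
    rw [this]
    have := integrable_pow_gaussianReal
    exact ((((this 8).sub ((this 6).const_mul 4)).add ((this 4).const_mul 6)).sub
      ((this 2).const_mul 4)).add (integrable_const 1)
  refine (integrable_norm_rpow_iff (by fun_prop) (by simp) (by simp)).1 ?_
  convert h using 2
  norm_cast

lemma integral_sq_sub_one_gaussianReal : ∫ x, (x ^ 2 - 1) ∂gaussianReal 0 1 = 0 := by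
  rw [integral_sub (integrable_pow_gaussianReal 2) (integrable_const 1),
    integral_pow_add_two_gaussianReal 0]
  simp

lemma integral_sq_sub_one_sq_gaussianReal : ∫ x, (x ^ 2 - 1) ^ 2 ∂gaussianReal 0 1 = 2 := by
  have hi := integrable_pow_gaussianReal
  calc ∫ x, (x ^ 2 - 1) ^ 2 ∂gaussianReal 0 1
      = ∫ x, (x ^ 4 - 2 * x ^ 2 + 1) ∂gaussianReal 0 1 := by congr 1; ext x; ring
    _ = 2 := by
      rw [integral_add ((hi 4).sub' ((hi 2).const_mul 2)) (integrable_const 1),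
        integral_sub (hi 4) ((hi 2).const_mul 2), integral_const_mul,
        integral_pow_add_two_gaussianReal 2, integral_pow_add_two_gaussianReal 0]
      norm_num

lemma integral_sq_sub_one_pow_four_gaussianReal :
    ∫ x, (x ^ 2 - 1) ^ 4 ∂gaussianReal 0 1 = 60 := by
  have hi := integrable_pow_gaussianReal
  have h4 := (hi 4).const_mul 6
  have h6 := (hi 6).const_mul 4
  have h2 := (hi 2).const_mul 4
  calc ∫ x, (x ^ 2 - 1) ^ 4 ∂gaussianReal 0 1
      = ∫ x, (x ^ 8 - 4 * x ^ 6 + 6 * x ^ 4 - 4 * x ^ 2 + 1) ∂gaussianReal 0 1 := by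
        congr 1; ext x; ring
    _ = 60 := by
      rw [integral_add ((((hi 8).sub' h6).fun_add h4).sub' h2) (integrable_const 1),
        integral_sub (((hi 8).sub' h6).fun_add h4) h2, integral_add ((hi 8).sub' h6) h4,
        integral_sub (hi 8) h6, integral_const_mul, integral_const_mul, integral_const_mul,
        integral_pow_add_two_gaussianReal 6, integral_pow_add_two_gaussianReal 4,
        integral_pow_add_two_gaussianReal 2, integral_pow_add_two_gaussianReal 0]
      norm_num

section IndependentSums

variable {Ω : Type*} {mΩ : MeasurableSpace Ω} {μ : Measure Ω} [IsProbabilityMeasure μ]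

lemma MeasureTheory.MemLp.integrable_pow_of_le_four {X : Ω → ℝ} (hX : MemLp X 4 μ) {n : ℕ}
    (hn : n ≤ 4) : Integrable (fun ω ↦ X ω ^ n) μ :=
  MemLp.integrable_pow (hX.mono_exponent (by exact_mod_cast hn))

lemma ProbabilityTheory.IndepFun.integral_add_sq {X Y : Ω → ℝ} (h : IndepFun X Y μ)
    (hX : MemLp X 4 μ) (hY : MemLp Y 4 μ) (hX0 : ∫ ω, X ω ∂μ = 0) :
    ∫ ω, (X ω + Y ω) ^ 2 ∂μ = ∫ ω, X ω ^ 2 ∂μ + ∫ ω, Y ω ^ 2 ∂μ := by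
  have hXY : ∫ ω, X ω * Y ω ∂μ = 0 := by
    rw [h.integral_fun_mul_eq_mul_integral hX.1 hY.1, hX0, zero_mul]
  have hi : Integrable (fun ω ↦ X ω * Y ω) μ :=
    h.integrable_mul (hX.integrable (by norm_num)) (hY.integrable (by norm_num))
  have hX2 := hX.integrable_pow_of_le_four (n := 2) (by norm_num)
  have hY2 := hY.integrable_pow_of_le_four (n := 2) (by norm_num)
  calc ∫ ω, (X ω + Y ω) ^ 2 ∂μ = ∫ ω, (X ω ^ 2 + 2 * (X ω * Y ω) + Y ω ^ 2) ∂μ := by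
        congr 1; ext ω; ring
    _ = _ := by
      rw [integral_add (hX2.fun_add (hi.const_mul 2)) hY2, integral_add hX2 (hi.const_mul 2),
        integral_const_mul, hXY]
      ring

lemma ProbabilityTheory.IndepFun.integral_add_pow_four {X Y : Ω → ℝ} (h : IndepFun X Y μ)
    (hX : MemLp X 4 μ) (hY : MemLp Y 4 μ) (hX0 : ∫ ω, X ω ∂μ = 0) (hY0 : ∫ ω, Y ω ∂μ = 0) :
    ∫ ω, (X ω + Y ω) ^ 4 ∂μ =
      ∫ ω, X ω ^ 4 ∂μ + 6 * (∫ ω, X ω ^ 2 ∂μ) * (∫ ω, Y ω ^ 2 ∂μ) + ∫ ω, Y ω ^ 4 ∂μ := by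
  have hind (m n : ℕ) : IndepFun (fun ω ↦ X ω ^ m) (fun ω ↦ Y ω ^ n) μ :=
    h.comp (φ := fun x ↦ x ^ m) (ψ := fun x ↦ x ^ n) (by fun_prop) (by fun_prop)
  have hmul (m n : ℕ) : ∫ ω, X ω ^ m * Y ω ^ n ∂μ = (∫ ω, X ω ^ m ∂μ) * ∫ ω, Y ω ^ n ∂μ :=
    (hind m n).integral_fun_mul_eq_mul_integral (hX.1.pow m) (hY.1.pow n)
  have hi {m n : ℕ} (hm : m ≤ 4) (hn : n ≤ 4) : Integrable (fun ω ↦ X ω ^ m * Y ω ^ n) μ :=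
    (hind m n).integrable_mul (hX.integrable_pow_of_le_four hm)
      (hY.integrable_pow_of_le_four hn)
  have h4 := hX.integrable_pow_of_le_four le_rfl
  have h31 := (hi (m := 3) (n := 1) (by norm_num) (by norm_num)).const_mul 4
  have h22 := (hi (m := 2) (n := 2) (by norm_num) (by norm_num)).const_mul 6
  have h13 := (hi (m := 1) (n := 3) (by norm_num) (by norm_num)).const_mul 4
  calc ∫ ω, (X ω + Y ω) ^ 4 ∂μ
      = ∫ ω, (X ω ^ 4 + 4 * (X ω ^ 3 * Y ω ^ 1) + 6 * (X ω ^ 2 * Y ω ^ 2)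
          + 4 * (X ω ^ 1 * Y ω ^ 3) + Y ω ^ 4) ∂μ := by
        congr 1; ext ω; ring
    _ = _ := by
      rw [integral_add (((h4.fun_add h31).fun_add h22).fun_add h13) (hY.integrable_pow_of_le_four le_rfl),
        integral_add ((h4.fun_add h31).fun_add h22) h13, integral_add (h4.fun_add h31) h22,
        integral_add h4 h31, integral_const_mul, integral_const_mul, integral_const_mul,
        hmul, hmul, hmul]
      simp only [pow_one, hX0, hY0]
      ring

variable {ι : Type*} {X : ι → Ω → ℝ}

lemma ProbabilityTheory.iIndepFun.integral_sum_sq (h : iIndepFun X μ)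
    (hX : ∀ i, MemLp (X i) 4 μ) (hX0 : ∀ i, ∫ ω, X i ω ∂μ = 0) (s : Finset ι) :
    ∫ ω, (∑ i ∈ s, X i ω) ^ 2 ∂μ = ∑ i ∈ s, ∫ ω, X i ω ^ 2 ∂μ := by
  classical
  induction s using Finset.induction_on with
  | empty => simp
  | insert a s ha ih =>
    simp only [Finset.sum_insert ha]
    have hind : IndepFun (X a) (fun ω ↦ ∑ i ∈ s, X i ω) μ := by
      simpa only [Finset.sum_fn] using
        (h.indepFun_finsetSum_of_notMem₀ (fun i ↦ (hX i).1.aemeasurable) ha).symm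
    rw [hind.integral_add_sq (hX a) (memLp_finsetSum s fun i _ ↦ hX i) (hX0 a), ih]

lemma ProbabilityTheory.iIndepFun.integral_sum_pow_four (h : iIndepFun X μ)
    (hX : ∀ i, MemLp (X i) 4 μ) (hX0 : ∀ i, ∫ ω, X i ω ∂μ = 0) (s : Finset ι) :
    ∫ ω, (∑ i ∈ s, X i ω) ^ 4 ∂μ =
      ∑ i ∈ s, (∫ ω, X i ω ^ 4 ∂μ - 3 * (∫ ω, X i ω ^ 2 ∂μ) ^ 2)
        + 3 * (∑ i ∈ s, ∫ ω, X i ω ^ 2 ∂μ) ^ 2 := by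
  classical
  induction s using Finset.induction_on with
  | empty => simp
  | insert a s ha ih =>
    simp only [Finset.sum_insert ha]
    have hind : IndepFun (X a) (fun ω ↦ ∑ i ∈ s, X i ω) μ := by
      simpa only [Finset.sum_fn] using
        (h.indepFun_finsetSum_of_notMem₀ (fun i ↦ (hX i).1.aemeasurable) ha).symm
    have hsum0 : ∫ ω, ∑ i ∈ s, X i ω ∂μ = 0 := by
      rw [integral_finsetSum s fun i _ ↦ (hX i).integrable (by norm_num)]
      simp [hX0]
    rw [hind.integral_add_pow_four (hX a) (memLp_finsetSum s fun i _ ↦ hX i) (hX0 a) hsum0, ih,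
      h.integral_sum_sq hX hX0]
    ring

end IndependentSums

section Spectral

variable {n : Type*} [Fintype n] [DecidableEq n] {S : Matrix n n ℝ}

lemma Matrix.IsHermitian.trace_pow_eq_sum_eigenvalues_pow (hS : S.IsHermitian) (k : ℕ) :
    (S ^ k).trace = ∑ i, hS.eigenvalues i ^ k := by
  conv_lhs => rw [hS.spectral_theorem, ← map_pow, Unitary.conjStarAlgAut_apply, trace_mul_comm,
    ← mul_assoc, Unitary.coe_star_mul_self, one_mul, diagonal_pow, trace_diagonal]
  simp

lemma Matrix.IsHermitian.dotProduct_mulVec_eigenvectorUnitary (hS : S.IsHermitian) (y : n → ℝ) :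
    ((hS.eigenvectorUnitary : Matrix n n ℝ) *ᵥ y) ⬝ᵥ
        (S *ᵥ ((hS.eigenvectorUnitary : Matrix n n ℝ) *ᵥ y)) =
      ∑ i, hS.eigenvalues i * y i ^ 2 := by
  have h := hS.conjStarAlgAut_star_eigenvectorUnitary
  rw [Unitary.conjStarAlgAut_star_apply] at h
  rw [dotProduct_comm, dotProduct_mulVec, ← mulVec_transpose, mulVec_mulVec, mulVec_mulVec]
  have h' : (hS.eigenvectorUnitary : Matrix n n ℝ)ᵀ * S * hS.eigenvectorUnitary =
      diagonal hS.eigenvalues := by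
    simpa [star_eq_conjTranspose, Function.comp_def] using h
  rw [h', dotProduct]
  refine Finset.sum_congr rfl fun i _ ↦ ?_
  rw [mulVec_diagonal]
  ring

lemma Matrix.IsHermitian.measurePreserving_eigenvectorUnitary_mulVec (hS : S.IsHermitian) :
    MeasurePreserving (fun y ↦ (hS.eigenvectorUnitary : Matrix n n ℝ) *ᵥ y)
      (Measure.pi fun _ ↦ gaussianReal 0 1) (Measure.pi fun _ ↦ gaussianReal 0 1) := by
  refine ⟨by fun_prop, ?_⟩
  have h := (stdGaussian_eq_map_pi_orthonormalBasis hS.eigenvectorBasis).symm.trans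
    (map_pi_eq_stdGaussian (ι := n)).symm
  have h' := congrArg (Measure.map (WithLp.ofLp (p := 2))) h
  rw [Measure.map_map (by fun_prop) (by fun_prop), Measure.map_map (by fun_prop) (by fun_prop)]
    at h'
  convert h' using 1
  · congr 1
    ext y i
    simp [mulVec, dotProduct, mul_comm]
  · exact Measure.map_id.symm

end Spectral

lemma Matrix.dotProduct_add_transpose_mulVec {n : Type*} [Fintype n] (A : Matrix n n ℝ)
    (x : n → ℝ) : x ⬝ᵥ ((A + Aᵀ) *ᵥ x) = 2 * (x ⬝ᵥ (A *ᵥ x)) := by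
  rw [add_mulVec, dotProduct_add, mulVec_transpose, dotProduct_comm x (x ᵥ* A),
    ← dotProduct_mulVec]
  ring


/-- If `x ~ N_p(0, I_p)` and `A` is any real `p × p` matrix, then
`E[(x'Ax − tr A)⁴] = 3 tr((A+Aᵀ)⁴) + (3/4) (tr((A+Aᵀ)²))²`. -/
theorem centered_fourth_moment_quadratic_form (p : ℕ)
    (A : Matrix (Fin p) (Fin p) ℝ) :
    ∫ x, (x ⬝ᵥ A.mulVec x - A.trace) ^ 4 ∂(stdGaussian p)
      = 3 * ((A + Aᵀ) * (A + Aᵀ) * (A + Aᵀ) * (A + Aᵀ)).trace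
        + (3 / 4) * ((A + Aᵀ) * (A + Aᵀ)).trace ^ 2 := by
  have hS : (A + Aᵀ).IsHermitian := by
    simp [IsHermitian, conjTranspose_eq_transpose_of_trivial, add_comm]
  have hmp := hS.measurePreserving_eigenvectorUnitary_mulVec
  have htr (k : ℕ) := hS.trace_pow_eq_sum_eigenvalues_pow k
  let X (i : Fin p) (y : Fin p → ℝ) : ℝ := hS.eigenvalues i / 2 * (y i ^ 2 - 1)
  have hquad (y : Fin p → ℝ) :
      ((hS.eigenvectorUnitary : Matrix (Fin p) (Fin p) ℝ) *ᵥ y) ⬝ᵥ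
        (A *ᵥ ((hS.eigenvectorUnitary : Matrix (Fin p) (Fin p) ℝ) *ᵥ y)) - A.trace =
      ∑ i, X i y := by
    have h1 := hS.dotProduct_mulVec_eigenvectorUnitary y
    rw [dotProduct_add_transpose_mulVec] at h1
    have h2 := htr 1
    simp only [pow_one, trace_add, trace_transpose] at h2
    have h3 : ∑ i, X i y =
        (∑ i, hS.eigenvalues i * y i ^ 2 - ∑ i, hS.eigenvalues i) / 2 := by
      rw [← Finset.sum_sub_distrib, Finset.sum_div]
      exact Finset.sum_congr rfl fun i _ ↦ by simp only [X]; ring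
    rw [h3, ← h1, ← h2]
    ring
  have hind : iIndepFun X (Measure.pi fun _ ↦ gaussianReal 0 1) :=
    iIndepFun_pi (X := fun i (t : ℝ) ↦ hS.eigenvalues i / 2 * (t ^ 2 - 1))
      fun i ↦ by fun_prop
  have hmem (i : Fin p) : MemLp (X i) 4 (Measure.pi fun _ ↦ gaussianReal 0 1) :=
    (memLp_sq_sub_one_gaussianReal.const_mul (hS.eigenvalues i / 2)).comp_measurePreserving
      (measurePreserving_eval (fun _ ↦ gaussianReal 0 1) i)
  have hint (i : Fin p) (k : ℕ) : ∫ y, X i y ^ k ∂(Measure.pi fun _ ↦ gaussianReal 0 1) =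
      (hS.eigenvalues i / 2) ^ k * ∫ t, (t ^ 2 - 1) ^ k ∂gaussianReal 0 1 := by
    rw [← integral_const_mul]
    simp only [X, mul_pow]
    exact integral_comp_eval (μ := fun _ : Fin p ↦ gaussianReal 0 1)
      (f := fun t : ℝ ↦ (hS.eigenvalues i / 2) ^ k * (t ^ 2 - 1) ^ k) (by fun_prop)
  have hmean (i : Fin p) : ∫ y, X i y ∂(Measure.pi fun _ ↦ gaussianReal 0 1) = 0 := by
    simpa [integral_sq_sub_one_gaussianReal] using hint i 1
  have h2 : ((A + Aᵀ) * (A + Aᵀ)).trace = ∑ i, hS.eigenvalues i ^ 2 := by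
    rw [← htr 2, sq]
  have h4 : ((A + Aᵀ) * (A + Aᵀ) * (A + Aᵀ) * (A + Aᵀ)).trace = ∑ i, hS.eigenvalues i ^ 4 := by
    rw [← htr 4]
    congr 1
    noncomm_ring
  rw [_root_.stdGaussian, h2, h4, ← hmp.map_eq,
    integral_map hmp.measurable.aemeasurable (by rw [hmp.map_eq]; fun_prop)]
  simp_rw [hquad]
  rw [hind.integral_sum_pow_four hmem hmean]
  simp only [hint, integral_sq_sub_one_sq_gaussianReal, integral_sq_sub_one_pow_four_gaussianReal]
  rw [← Finset.sum_mul, Finset.mul_sum]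
  have e2 : ∑ i, (hS.eigenvalues i / 2) ^ 2 = (∑ i, hS.eigenvalues i ^ 2) / 4 := by
    rw [Finset.sum_div]
    exact Finset.sum_congr rfl fun i _ ↦ by ring
  rw [e2]
  congr 1
  · exact Finset.sum_congr rfl fun i _ ↦ by ring
  · ring
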